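/- For every n ≥ 1 and t > 0, the quantities r_n satisfy the non-linear second order difference equation −4(−1)^n t r_n(t) = (n + r_n(t)) (r_{n+1}(t) + r_n(t)) (r_n(t) + r_{n−1}(t)), where by convention r_0(t) = 0. -/

import Mathlib

open MeasureTheory Polynomial

/-- The singularly perturbed Gaussian weight `w(x,t) = exp(-x^2 - t/x^2)` for `x ≠ 0`,
extended by `0` at `x = 0`. -/
noncomputable def w (t x : ℝ) : ℝ := if x = 0 then 0 else Real.exp (-x ^ 2 - t / x ^ 2)

section OrthogonalPolynomials

variable {K : Type*} [Field K] {M : K[X] →ₗ[K] K} {P : ℕ → K[X]} {h : ℕ → K}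

/-- `P` is a sequence of monic orthogonal polynomials for the functional `M`, with squared
norms `h`. -/
structure IsMonicOrthogonal (M : K[X] →ₗ[K] K) (P : ℕ → K[X]) (h : ℕ → K) : Prop where
  monic : ∀ n, (P n).Monic
  natDegree_eq : ∀ n, (P n).natDegree = n
  orthogonal : ∀ m n, m ≠ n → M (P m * P n) = 0
  norm_sq : ∀ n, M (P n * P n) = h n
  norm_ne_zero : ∀ n, h n ≠ 0

namespace IsMonicOrthogonal

lemma coeff_self (hP : IsMonicOrthogonal M P h) (n : ℕ) : (P n).coeff n = 1 := by
  simpa [hP.natDegree_eq n] using (hP.monic n).coeff_natDegree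

lemma coeff_of_lt (hP : IsMonicOrthogonal M P h) {n k : ℕ} (hk : n < k) : (P n).coeff k = 0 :=
  coeff_eq_zero_of_natDegree_lt (by rwa [hP.natDegree_eq])

lemma apply_mul_of_coeff_eq_zero (hP : IsMonicOrthogonal M P h) {n : ℕ} {q : K[X]}
    (hq : ∀ k, n ≤ k → q.coeff k = 0) : M (P n * q) = 0 := by
  suffices ∀ j ≤ n, ∀ q : K[X], (∀ k, j ≤ k → q.coeff k = 0) → M (P n * q) = 0 from
    this n le_rfl q hq
  intro j
  induction j with
  | zero =>
    intro _ q hq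
    have : q = 0 := by ext k; simpa using hq k (Nat.zero_le k)
    simp [this]
  | succ j ih =>
    intro hj q hq
    have hlow : M (P n * (q - q.coeff j • P j)) = 0 := by
      refine ih (by omega) _ fun k hk => ?_
      rcases hk.eq_or_lt with rfl | hk
      · simp [hP.coeff_self]
      · simp [hP.coeff_of_lt hk, hq k hk]
    rw [mul_sub, mul_smul_comm, map_sub, map_smul, hP.orthogonal n j (by omega)] at hlow
    simpa using hlow

lemma apply_mul_of_coeff_eq_zero_of_lt (hP : IsMonicOrthogonal M P h) {n : ℕ} {q : K[X]}
    (hq : ∀ k, n < k → q.coeff k = 0) : M (P n * q) = q.coeff n * h n := by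
  have hlow : M (P n * (q - q.coeff n • P n)) = 0 := by
    refine hP.apply_mul_of_coeff_eq_zero fun k hk => ?_
    rcases hk.eq_or_lt with rfl | hk
    · simp [hP.coeff_self]
    · simp [hP.coeff_of_lt hk, hq k hk]
  rw [mul_sub, mul_smul_comm, map_sub, map_smul, hP.norm_sq, smul_eq_mul] at hlow
  exact sub_eq_zero.1 hlow

lemma eq_zero_of_forall_apply_mul (hP : IsMonicOrthogonal M P h) {q : K[X]}
    (hq : ∀ k ≤ q.natDegree, M (P k * q) = 0) : q = 0 := by
  have hlead := hP.apply_mul_of_coeff_eq_zero_of_lt (n := q.natDegree) (q := q)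
    fun k hk => coeff_eq_zero_of_natDegree_lt hk
  rw [hq _ le_rfl, eq_comm, mul_eq_zero] at hlead
  simpa using hlead.resolve_right (hP.norm_ne_zero _)

lemma comp_neg_X (hP : IsMonicOrthogonal M P h) (hM : ∀ p : K[X], M (p.comp (-X)) = M p)
    (n : ℕ) : (P n).comp (-X) = (-1) ^ n * P n := by
  have hcoeff : ∀ (p : K[X]) (k : ℕ), (p.comp (-X)).coeff k = (-1) ^ k * p.coeff k := by
    intro p k
    rw [show (-X : K[X]) = C (-1) * X by simp, comp_C_mul_X_coeff, mul_comm]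
  have hmul : ∀ q : K[X], (((-1) ^ n : K[X]) * q) = ((-1 : K) ^ n) • q := by
    intro q; rw [smul_eq_C_mul]; simp
  have hD : ∀ k, n ≤ k → ((P n).comp (-X) - (-1) ^ n * P n).coeff k = 0 := by
    intro k hk
    rw [coeff_sub, hcoeff, hmul, coeff_smul, smul_eq_mul]
    rcases hk.eq_or_lt with rfl | hk
    · simp
    · simp [hP.coeff_of_lt hk]
  refine sub_eq_zero.1 (hP.eq_zero_of_forall_apply_mul fun k hk => ?_)
  rcases lt_or_ge k n with hkn | hkn
  · have hpk : ∀ j, n ≤ j → (P k).coeff j = 0 := fun j hj => hP.coeff_of_lt (by omega)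
    have hflip : P k * (P n).comp (-X) = (P n * (P k).comp (-X)).comp (-X) := by
      simp [mul_comp, comp_assoc, mul_comm]
    rw [mul_sub, map_sub, hflip, hM, hP.apply_mul_of_coeff_eq_zero
        fun j hj => by rw [hcoeff, hpk j hj, mul_zero], mul_left_comm, hmul, map_smul,
      hP.orthogonal _ _ hkn.ne]
    simp
  · exact hP.apply_mul_of_coeff_eq_zero fun j hj => hD j (hkn.trans hj)

lemma coeff_of_odd [CharZero K] (hP : IsMonicOrthogonal M P h)
    (hM : ∀ p : K[X], M (p.comp (-X)) = M p) {n k : ℕ} (hnk : Odd (n + k)) :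
    (P n).coeff k = 0 := by
  have hc := congrArg (fun p : K[X] => p.coeff k) (hP.comp_neg_X hM n)
  beta_reduce at hc
  rw [show (-X : K[X]) = C (-1) * X by simp, comp_C_mul_X_coeff,
    show ((-1 : K[X]) ^ n) = C ((-1) ^ n) by simp, coeff_C_mul] at hc
  have hsign : (-1 : K) ^ n * (-1) ^ k = -1 := by rw [← pow_add, hnk.neg_one_pow]
  have hsq : (-1 : K) ^ n * (-1) ^ n = 1 := by rw [← pow_add, Even.neg_one_pow ⟨n, rfl⟩]
  have h2 : (2 : K) * (P n).coeff k = 0 := by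
    linear_combination (P n).coeff k * hsign - (-1) ^ n * hc - (P n).coeff k * hsq
  simpa using h2

lemma X_mul_zero [CharZero K] (hP : IsMonicOrthogonal M P h)
    (hM : ∀ p : K[X], M (p.comp (-X)) = M p) : X * P 0 = P 1 := by
  ext k
  rcases k with _ | _ | k
  · simp [hP.coeff_of_odd hM (n := 1) (k := 0) (by decide)]
  · simp [coeff_X_mul, hP.coeff_self]
  · rw [coeff_X_mul, hP.coeff_of_lt (by omega), hP.coeff_of_lt (by omega)]

lemma X_mul_succ [CharZero K] (hP : IsMonicOrthogonal M P h)
    (hM : ∀ p : K[X], M (p.comp (-X)) = M p) (n : ℕ) :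
    X * P (n + 1) = P (n + 2) + (h (n + 1) / h n) • P n := by
  have hD : ∀ k, n + 1 ≤ k →
      (X * P (n + 1) - (P (n + 2) + (h (n + 1) / h n) • P n)).coeff k = 0 := by
    intro k hk
    obtain ⟨k, rfl⟩ : ∃ j, k = j + 1 := ⟨k - 1, by omega⟩
    rw [coeff_sub, coeff_add, coeff_smul, coeff_X_mul, hP.coeff_of_lt (n := n) (by omega)]
    rcases (show k = n ∨ k = n + 1 ∨ n + 1 < k by omega) with rfl | rfl | hk
    · rw [hP.coeff_of_odd hM ⟨k, by omega⟩, hP.coeff_of_odd hM ⟨k + 1, by omega⟩]; simp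
    · simp [hP.coeff_self]
    · rw [hP.coeff_of_lt hk, hP.coeff_of_lt (by omega)]; simp
  refine sub_eq_zero.1 (hP.eq_zero_of_forall_apply_mul fun k _ => ?_)
  rcases le_or_gt (n + 1) k with hkn | hkn
  · exact hP.apply_mul_of_coeff_eq_zero fun j hj => hD j (hkn.trans hj)
  have hshift : M (P k * (X * P (n + 1))) = (P k).coeff n * h (n + 1) := by
    rw [show P k * (X * P (n + 1)) = P (n + 1) * (X * P k) by ring,
      hP.apply_mul_of_coeff_eq_zero_of_lt, coeff_X_mul]
    intro j hj
    obtain ⟨j, rfl⟩ : ∃ i, j = i + 1 := ⟨j - 1, by omega⟩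
    rw [coeff_X_mul, hP.coeff_of_lt (by omega)]
  rw [mul_sub, mul_add, mul_smul_comm, map_sub, map_add, map_smul, hshift,
    hP.orthogonal k (n + 2) (by omega), smul_eq_mul]
  rcases (show k = n ∨ k < n by omega) with rfl | hk
  · rw [hP.coeff_self, hP.norm_sq, div_mul_cancel₀ _ (hP.norm_ne_zero _)]; ring
  · rw [hP.coeff_of_lt hk, hP.orthogonal _ _ hk.ne]; ring

end IsMonicOrthogonal

end OrthogonalPolynomials

section CubicDivision

variable {K : Type*} [Field K] {L M : K[X] →ₗ[K] K} {P : ℕ → K[X]} {h : ℕ → K}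

lemma eq_C_add_X_sq_mul_divX {q : K[X]} (hq : q.coeff 1 = 0) :
    q = C (q.coeff 0) + X ^ 2 * q.divX.divX := by
  ext k
  rcases k with _ | _ | k
  · simp
  · simp [hq, coeff_X_pow_mul']
  · simp [coeff_X_pow_mul']

namespace IsMonicOrthogonal

/-- Moments of `P e` and `P o` for adjacent indices `e` (even) and `o` (odd), where
`P o = X * S` and `P e = C a + X ^ 2 * p`, and `a` and `b` are the constant terms of `P e` and
`S`. -/
lemma exists_parity_expansion [CharZero K] (hP : IsMonicOrthogonal M P h)
    (hM : ∀ p : K[X], M (p.comp (-X)) = M p) (hL : ∀ p, L (X ^ 3 * p) = M p)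
    {e o : ℕ} (he : Even e) (ho : Odd o) (heo : e ≤ o + 1) (hoe : o ≤ e + 1) :
    ∃ (a b μ : K) (S p : K[X]), P o = X * S ∧
      M (P e * S) = a * μ + M (P o * (X * p)) ∧
      L (P o * P e) = b * L (X * P e) ∧
      L (X * P o ^ 2) = b * μ ∧ L (X * P e ^ 2) = a * L (X * P e) ∧
      (∀ k, p.coeff k = (P e).coeff (k + 2)) := by
  have hO : P o = X * (P o).divX := by
    conv_lhs => rw [← X_mul_divX_add (P o)]
    simp [hP.coeff_of_odd hM (n := o) (k := 0) ho]
  set S := (P o).divX with hS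
  have hS1 : S.coeff 1 = 0 := by
    rw [hS, coeff_divX]; exact hP.coeff_of_odd hM (by grind)
  have hE := eq_C_add_X_sq_mul_divX (hP.coeff_of_odd hM (n := e) (k := 1) he.add_one)
  have hSe := eq_C_add_X_sq_mul_divX hS1
  set a := (P e).coeff 0
  set b := S.coeff 0
  set p := (P e).divX.divX with hp
  set s := S.divX.divX with hs
  have hsE : M (P e * s) = 0 := hP.apply_mul_of_coeff_eq_zero fun k hk => by
    simp only [hs, hS, coeff_divX]; exact hP.coeff_of_lt (by omega)
  have hpE : M (P e * p) = 0 := hP.apply_mul_of_coeff_eq_zero fun k hk => by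
    simp only [hp, coeff_divX]; exact hP.coeff_of_lt (by omega)
  have hsO : M (P o * (X * s)) = 0 := hP.apply_mul_of_coeff_eq_zero fun k hk => by
    rcases k with _ | k
    · simp
    · simp only [hs, hS, coeff_X_mul, coeff_divX]; exact hP.coeff_of_lt (by omega)
  refine ⟨a, b, M S, S, p, hO, ?_, ?_, ?_, ?_, fun k => by simp [hp, coeff_divX]⟩
  · rw [show P e * S = a • S + P o * (X * p) by
      rw [hO, smul_eq_C_mul]; nth_rw 1 [hE]; ring]
    simp
  · rw [show P o * P e = b • (X * P e) + X ^ 3 * (P e * s) by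
      rw [hO, smul_eq_C_mul]; nth_rw 1 [hSe]; ring]
    simp [hL, hsE]
  · rw [show X * P o ^ 2 = X ^ 3 * (b • S + P o * (X * s)) by
      rw [hO, smul_eq_C_mul]
      linear_combination X ^ 3 * S * hSe]
    rw [hL]; simp [hsO]
  · rw [show X * P e ^ 2 = a • (X * P e) + X ^ 3 * (P e * p) by
      rw [smul_eq_C_mul]; linear_combination X * P e * hE]
    simp [hL, hpE]

lemma apply_X_mul_sq_mul_apply_X_mul_sq [CharZero K] (hP : IsMonicOrthogonal M P h)
    (hM : ∀ p : K[X], M (p.comp (-X)) = M p) (hL : ∀ p, L (X ^ 3 * p) = M p) (n : ℕ) :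
    L (X * P (n + 1) ^ 2) * L (X * P n ^ 2) = (-1) ^ n * h n * L (P (n + 1) * P n) := by
  rcases Nat.even_or_odd n with hn | hn
  · obtain ⟨a, b, μ, S, p, hO, hES, hJ, hIo, hIe, hp⟩ :=
      hP.exists_parity_expansion hM hL hn hn.add_one (by omega) le_rfl
    have hSc : ∀ k, S.coeff k = (P (n + 1)).coeff (k + 1) := fun k => by rw [hO, coeff_X_mul]
    rw [hP.apply_mul_of_coeff_eq_zero_of_lt
        fun k hk => by rw [hSc]; exact hP.coeff_of_lt (by omega),
      hSc, hP.coeff_self, hP.apply_mul_of_coeff_eq_zero] at hES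
    · rw [hIo, hIe, hJ, hn.neg_one_pow]
      linear_combination -(b * L (X * P n)) * hES
    · rintro (_ | k) hk
      · simp
      · rw [coeff_X_mul, hp]; exact hP.coeff_of_lt (by omega)
  · obtain ⟨a, b, μ, S, p, hO, hES, hJ, hIo, hIe, hp⟩ :=
      hP.exists_parity_expansion hM hL hn.add_one hn le_rfl (by omega)
    have hSc : ∀ k, S.coeff k = (P n).coeff (k + 1) := fun k => by rw [hO, coeff_X_mul]
    have hXp : ∀ k, 0 < k → (X * p).coeff k = (P (n + 1)).coeff (k + 1) := by
      rintro (_ | k) hk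
      · omega
      · rw [coeff_X_mul, hp]
    rw [hP.apply_mul_of_coeff_eq_zero fun k hk => by rw [hSc]; exact hP.coeff_of_lt (by omega),
      hP.apply_mul_of_coeff_eq_zero_of_lt, hXp n hn.pos, hP.coeff_self] at hES
    · rw [hIo, hIe, mul_comm (P (n + 1)), hJ, hn.neg_one_pow]
      linear_combination -(b * L (X * P (n + 1))) * hES
    · intro k hk
      rw [hXp k (by omega)]; exact hP.coeff_of_lt (by omega)

/-- The Pearson equation `hpearson` for `L` turns into a relation between the norms. -/
lemma pearson_norm_relation (hP : IsMonicOrthogonal M P h) {t : K}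
    (hpearson : ∀ p, M (derivative p) - 2 * M (X * p) + 2 * t * L p = 0) (n : ℕ) :
    (n + 1) * h n + 2 * t * L (P (n + 1) * P n) = 2 * h (n + 1) := by
  have hpear := hpearson (P (n + 1) * P n)
  have hd1 : M (P n * derivative (P (n + 1))) = (n + 1) * h n := by
    rw [hP.apply_mul_of_coeff_eq_zero_of_lt, coeff_derivative, hP.coeff_self, one_mul]
    intro k hk
    rw [coeff_derivative, hP.coeff_of_lt (by omega), zero_mul]
  have hd2 : M (P (n + 1) * derivative (P n)) = 0 := hP.apply_mul_of_coeff_eq_zero fun k hk => by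
    rw [coeff_derivative, hP.coeff_of_lt (by omega), zero_mul]
  have hx : M (P (n + 1) * (X * P n)) = h (n + 1) := by
    rw [hP.apply_mul_of_coeff_eq_zero_of_lt, coeff_X_mul, hP.coeff_self, one_mul]
    rintro (_ | k) hk
    · omega
    · rw [coeff_X_mul, hP.coeff_of_lt (by omega)]
  rw [derivative_mul, map_add, mul_comm (derivative (P (n + 1))), hd1, hd2,
    mul_left_comm X, hx] at hpear
  linear_combination hpear

theorem difference_equation [CharZero K] (hP : IsMonicOrthogonal M P h)
    (hM : ∀ p : K[X], M (p.comp (-X)) = M p) (hL : ∀ p, L (X ^ 3 * p) = M p) {t : K}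
    (hpearson : ∀ p, M (derivative p) - 2 * M (X * p) + 2 * t * L p = 0)
    {r : ℕ → K} (hr : ∀ n, r (n + 1) = 2 * t / h n * L (P (n + 1) * P n)) (hr0 : r 0 = 0)
    (n : ℕ) :
    4 * (-1) ^ n * t * r (n + 1)
      = ((n + 1 : K) + r (n + 1)) * (r (n + 2) + r (n + 1)) * (r (n + 1) + r n) := by
  have hsum : ∀ n, r (n + 1) + r n = 2 * t / h n * L (X * P n ^ 2) := by
    rintro (_ | n)
    · rw [hr0, hr, ← hP.X_mul_zero hM, sq, mul_assoc, add_zero]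
    · have h0 := hP.norm_ne_zero n
      have h1 := hP.norm_ne_zero (n + 1)
      rw [hr, hr, sq, ← mul_assoc, hP.X_mul_succ hM, add_mul, smul_mul_assoc, map_add, map_smul,
        smul_eq_mul, mul_comm (P n)]
      field_simp
  have h0 := hP.norm_ne_zero n
  have h1 := hP.norm_ne_zero (n + 1)
  have hnorm : (n + 1 : K) + r (n + 1) = 2 * h (n + 1) / h n := by
    rw [hr, ← hP.pearson_norm_relation hpearson n]
    field_simp
  have hprod := hP.apply_X_mul_sq_mul_apply_X_mul_sq hM hL n
  rw [hnorm, hsum, hsum, hr]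
  field_simp
  linear_combination (-4 * t ^ 2) * hprod

end IsMonicOrthogonal

end CubicDivision

section Weight

variable {t : ℝ}

lemma w_neg (t x : ℝ) : w t (-x) = w t x := by simp [w]

lemma w_nonneg (t x : ℝ) : 0 ≤ w t x := by
  unfold w; split_ifs <;> positivity

lemma measurable_w (t : ℝ) : Measurable (w t) := by
  unfold w
  exact Measurable.ite (measurableSet_singleton 0) measurable_const (by fun_prop)

lemma w_le (ht : 0 < t) (x : ℝ) : w t x ≤ 2 / t ^ 2 * x ^ 4 * Real.exp (-x ^ 2) := by
  unfold w
  split_ifs with hx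
  · positivity
  · have hu : 0 < t / x ^ 2 := by positivity
    have hq := Real.quadratic_le_exp_of_nonneg hu.le
    have hle : Real.exp (-(t / x ^ 2)) ≤ 2 / t ^ 2 * x ^ 4 := by
      rw [Real.exp_neg, inv_le_comm₀ (Real.exp_pos _) (by positivity)]
      calc (2 / t ^ 2 * x ^ 4)⁻¹ = (t / x ^ 2) ^ 2 / 2 := by field_simp
        _ ≤ _ := by linarith
    rw [sub_eq_add_neg, Real.exp_add, mul_comm]
    gcongr

lemma integrable_pow_mul_exp_neg_sq (n : ℕ) :
    Integrable fun x : ℝ => x ^ n * Real.exp (-x ^ 2) := by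
  simpa using integrable_rpow_mul_exp_neg_mul_sq (b := 1) one_pos (s := n)
    (by have := n.cast_nonneg (α := ℝ); linarith)

lemma integrable_eval_mul_w_div (ht : 0 < t) (p : ℝ[X]) :
    Integrable fun x => p.eval x * (w t x / x ^ 3) := by
  induction p using Polynomial.induction_on' with
  | add p q hp hq => simpa only [eval_add, add_mul] using Integrable.fun_add hp hq
  | monomial n a =>
    simp only [eval_monomial, mul_assoc]
    refine Integrable.const_mul ?_ a
    refine ((integrable_pow_mul_exp_neg_sq (n + 1)).const_mul (2 / t ^ 2)).mono ?_ ?_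
    · exact ((measurable_id.pow_const n).mul
        ((measurable_w t).div (measurable_id.pow_const 3))).aestronglyMeasurable
    · refine Filter.Eventually.of_forall fun x => ?_
      rcases eq_or_ne x 0 with rfl | hx
      · simp
      have hx' : 0 < |x| := abs_pos.2 hx
      rw [norm_mul, norm_mul, norm_mul, norm_div, norm_pow, norm_pow, norm_pow, Real.norm_eq_abs x,
        Real.norm_of_nonneg (w_nonneg t x), Real.norm_of_nonneg (Real.exp_pos _).le,
        Real.norm_of_nonneg (by positivity : 0 ≤ 2 / t ^ 2)]
      have hw := w_le ht x
      rw [show x ^ 4 = |x| ^ 4 from (Even.pow_abs (by decide) x).symm] at hw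
      calc |x| ^ n * (w t x / |x| ^ 3)
          ≤ |x| ^ n * (2 / t ^ 2 * |x| ^ 4 * Real.exp (-x ^ 2) / |x| ^ 3) := by gcongr
        _ = _ := by field_simp; ring

/-- The functional `p ↦ ∫ x⁻³ p(x) w(x,t) dx`. -/
noncomputable def cubicMoment (ht : 0 < t) : ℝ[X] →ₗ[ℝ] ℝ where
  toFun p := ∫ x, p.eval x * (w t x / x ^ 3)
  map_add' p q := by
    simp only [eval_add, add_mul]
    exact integral_add (integrable_eval_mul_w_div ht p) (integrable_eval_mul_w_div ht q)
  map_smul' a p := by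
    simp only [eval_smul, smul_eq_mul, mul_assoc, integral_const_mul, RingHom.id_apply]

lemma cubicMoment_apply (ht : 0 < t) (p : ℝ[X]) :
    cubicMoment ht p = ∫ x, p.eval x * (w t x / x ^ 3) := rfl

lemma eval_X_pow_three_mul (p : ℝ[X]) (x : ℝ) :
    (X ^ 3 * p).eval x * (w t x / x ^ 3) = p.eval x * w t x := by
  rcases eq_or_ne x 0 with rfl | hx
  · simp [w]
  · simp only [eval_mul, eval_pow, eval_X]; field_simp

lemma cubicMoment_X_pow_three_mul (ht : 0 < t) (p : ℝ[X]) :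
    cubicMoment ht (X ^ 3 * p) = ∫ x, p.eval x * w t x := by
  simp only [cubicMoment_apply, eval_X_pow_three_mul]

lemma integrable_eval_mul_w (ht : 0 < t) (p : ℝ[X]) :
    Integrable fun x => p.eval x * w t x :=
  (integrable_eval_mul_w_div ht (X ^ 3 * p)).congr (ae_of_all _ (eval_X_pow_three_mul p))

lemma hasDerivAt_w (ht : 0 < t) (x : ℝ) :
    HasDerivAt (w t) (-2 * x * w t x + 2 * t * (w t x / x ^ 3)) x := by
  rcases eq_or_ne x 0 with rfl | hx
  · have hO : w t =O[nhds 0] fun x : ℝ => ‖x - 0‖ ^ 2 := by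
      refine Asymptotics.IsBigO.of_bound (2 / t ^ 2) ?_
      filter_upwards [Metric.ball_mem_nhds (0 : ℝ) one_pos] with x hx
      have hx1 : x ^ 2 ≤ 1 := by
        rw [sq_le_one_iff_abs_le_one]; simpa using (mem_ball_zero_iff.1 hx).le
      rw [Real.norm_of_nonneg (w_nonneg t x), norm_pow, norm_norm, sub_zero, Real.norm_eq_abs,
        sq_abs]
      calc w t x ≤ 2 / t ^ 2 * x ^ 4 * Real.exp (-x ^ 2) := w_le ht x
        _ ≤ 2 / t ^ 2 * x ^ 4 :=
          mul_le_of_le_one_right (by positivity) (Real.exp_le_one_iff.2 (by nlinarith))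
        _ ≤ 2 / t ^ 2 * x ^ 2 := by gcongr ?_ * ?_; nlinarith [sq_nonneg x]
    simpa [w, hasDerivAt_iff_hasFDerivAt] using hO.hasFDerivAt one_lt_two
  · have hev : w t =ᶠ[nhds x] fun y => Real.exp (-y ^ 2 - t / y ^ 2) := by
      filter_upwards [isOpen_ne.mem_nhds hx] with y hy
      simp only [w]; rw [if_neg hy]
    rw [hev.self_of_nhds]
    refine HasDerivAt.congr_of_eventuallyEq ?_ hev
    have hsq : HasDerivAt (fun y : ℝ => y ^ 2) (2 * x) x := by simpa using hasDerivAt_pow 2 x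
    refine (hsq.fun_neg.fun_sub
      ((hasDerivAt_const x t).fun_div hsq (pow_ne_zero 2 hx))).exp.congr_deriv ?_
    field_simp
    ring

lemma cubicMoment_pearson (ht : 0 < t) (p : ℝ[X]) :
    cubicMoment ht (X ^ 3 * derivative p) - 2 * cubicMoment ht (X ^ 3 * (X * p)) +
      2 * t * cubicMoment ht p = 0 := by
  set q : ℝ[X] := X ^ 3 * derivative p - (2 : ℝ) • (X ^ 3 * (X * p)) + (2 * t) • p with hq
  have hderiv : ∀ x, HasDerivAt (fun x => p.eval x * w t x) (q.eval x * (w t x / x ^ 3)) x := by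
    intro x
    refine ((p.hasDerivAt x).fun_mul (hasDerivAt_w ht x)).congr_deriv (Eq.symm ?_)
    rw [hq, eval_add, eval_sub, eval_smul, eval_smul, add_mul, sub_mul, smul_eq_mul, smul_eq_mul,
      mul_assoc 2, eval_X_pow_three_mul, eval_X_pow_three_mul, eval_mul, eval_X]
    ring
  have hzero : cubicMoment ht q = 0 :=
    integral_eq_zero_of_hasDerivAt_of_integrable hderiv (integrable_eval_mul_w_div ht q)
      (integrable_eval_mul_w ht p)
  simpa [hq] using hzero

end Weight

theorem statement8
    (t : ℝ) (ht : 0 < t)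
    (P : ℕ → Polynomial ℝ)
    (hmonic : ∀ n, (P n).Monic)
    (hdeg : ∀ n, (P n).natDegree = n)
    (horth : ∀ m n : ℕ, m ≠ n → ∫ x : ℝ, (P m).eval x * (P n).eval x * w t x = 0)
    (h : ℕ → ℝ)
    (hh : ∀ n, h n = ∫ x : ℝ, ((P n).eval x) ^ 2 * w t x)
    (hhpos : ∀ n, 0 < h n)
    (r : ℕ → ℝ)
    (hr : ∀ n, 1 ≤ n → r n = 2 * t / h (n - 1) *
      ∫ y : ℝ, (P n).eval y * (P (n - 1)).eval y / y ^ 3 * w t y)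
    (hr0 : r 0 = 0)
    (n : ℕ) (hn : 1 ≤ n) :
    -4 * (-1 : ℝ) ^ n * t * r n
      = ((n : ℝ) + r n) * (r (n + 1) + r n) * (r n + r (n - 1)) := by
  obtain ⟨n, rfl⟩ : ∃ m, n = m + 1 := ⟨n - 1, by omega⟩
  let L := cubicMoment ht
  let M : ℝ[X] →ₗ[ℝ] ℝ := L ∘ₗ LinearMap.mulLeft ℝ (X ^ 3)
  have hM : ∀ p, M p = ∫ x, p.eval x * w t x := cubicMoment_X_pow_three_mul ht
  have hP : IsMonicOrthogonal M P h :=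
    { monic := hmonic
      natDegree_eq := hdeg
      orthogonal := fun m n hmn => by simpa only [hM, eval_mul] using horth m n hmn
      norm_sq := fun n => by simp only [hM, hh, eval_mul, sq]
      norm_ne_zero := fun n => (hhpos n).ne' }
  have heven : ∀ p : ℝ[X], M (p.comp (-X)) = M p := fun p => by
    rw [hM, hM, ← integral_neg_eq_self]
    simp [w_neg]
  have hrL : ∀ n, r (n + 1) = 2 * t / h n * L (P (n + 1) * P n) := fun n => by
    rw [hr (n + 1) (by omega), Nat.add_sub_cancel]
    simp only [L, cubicMoment_apply, eval_mul, div_mul_eq_mul_div, mul_div_assoc']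
  have hmain := hP.difference_equation heven (fun _ => rfl) (cubicMoment_pearson ht) hrL hr0 n
  rw [Nat.add_sub_cancel, Nat.cast_succ, ← hmain, pow_succ]
  ring
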